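/- arXiv:1111.2296 — 8 statements merged into one kernel-verified Lean document; each statement's English description precedes it below -/
import Mathlib

section
/- Let k ≥ 1 and let m₁, n₁, …, m_k, n_k be nonzero integers. Define the 2×2 integer matrix w = ∏_{j=1}^{k} [[1, 2m_j],[0,1]] · [[1,0],[−2n_j,1]] (the product taken in order j = 1, …, k), and set L = Σ_{j=1}^{k} (|m_j| + |n_j|). If |tr w| ≠ 2, then |tr w| ≥ 2L; and if moreover L is even, then |tr w| ≥ 4L − 6. -/
namespace TraceWord

/-- Common inequalities between the (sign-normalised) continuants. -/
def Common (X Y Z T L N : ℤ) : Prop :=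
  1 ≤ Y ∧ 1 ≤ Z ∧ 0 ≤ T ∧ 1 ≤ X - Z ∧ 1 ≤ Y - T ∧ Y - T ≤ X - Z ∧ 1 ≤ X - Y ∧ 1 ≤ Z - T ∧
    1 ≤ N ∧ N ≤ L

/-- All letters so far have the same sign. -/
def Pure (X Y Z T L N : ℤ) : Prop :=
  4 * L + 2 ≤ 2 * X + Y + Z ∧ N + 1 ≤ X ∧ 2 * (L - N) ≤ X - Y - Z + T ∧
    2 + 2 * N * (L - N) ≤ X - T ∧ (L = N → X - T = 2 ∧ X - Y - Z + T = 0)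

/-- A sign change has occurred. -/
def Mixed (σ X Y Z T L : ℤ) : Prop :=
  4 * L - 2 ≤ X - σ * T ∧ (σ = 1 → 4 ≤ X - Y - Z + T) ∧
    (σ = -1 → 4 ≤ X - Y + Z - T ∧ 4 ≤ X - Z + Y - T)

def Inv (σ X Y Z T L N : ℤ) : Prop :=
  Common X Y Z T L N ∧ ((σ = 1 ∧ Pure X Y Z T L N) ∨ Mixed σ X Y Z T L)

lemma common_step {ε e X Y Z T L N : ℤ} (hε : ε = 1 ∨ ε = -1) (he : 0 ≤ e)
    (h : Common X Y Z T L N) :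
    Common (2 * (e + 1) * X - ε * Y) X (2 * (e + 1) * Z - ε * T) Z (L + (e + 1)) (N + 1) := by
  obtain ⟨h1, h2, h3, h4, h5, h6, h7, h8, h9, h10⟩ := h
  have a1 : 0 ≤ e * (X - Z) := mul_nonneg he (by linarith)
  have a2 : 0 ≤ e * X := mul_nonneg he (by linarith)
  have a3 : 0 ≤ e * Z := mul_nonneg he (by linarith)
  rcases hε with rfl | rfl <;> refine ⟨?_, ?_, ?_, ?_, ?_, ?_, ?_, ?_, ?_, ?_⟩ <;> nlinarith

lemma inv_step {σ ε e X Y Z T L N : ℤ} (hσ : σ = 1 ∨ σ = -1) (hε : ε = 1 ∨ ε = -1) (he : 0 ≤ e)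
    (h : Inv σ X Y Z T L N) :
    Inv (σ * ε) (2 * (e + 1) * X - ε * Y) X (2 * (e + 1) * Z - ε * T) Z
      (L + (e + 1)) (N + 1) := by
  obtain ⟨hc, h⟩ := h
  refine ⟨common_step hε he hc, ?_⟩
  obtain ⟨h1, h2, h3, h4, h5, h6, h7, h8, h9, h10⟩ := hc
  have a1 : 0 ≤ e * (X - Z - 1) := mul_nonneg he (by linarith)
  have a2 : 0 ≤ e * (X - 2) := mul_nonneg he (by linarith)
  have a3 : 0 ≤ e * (Z - 1) := mul_nonneg he (by linarith)
  rcases h with ⟨rfl, p1, p2, p3, p4, p5⟩ | ⟨m1, m2, m3⟩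
  · have a4 : 0 ≤ e * (X - (N + 1)) := mul_nonneg he (by linarith)
    rcases hε with rfl | rfl
    · left
      refine ⟨by norm_num, ?_, ?_, ?_, ?_, ?_⟩
      · nlinarith
      · nlinarith
      · nlinarith
      · nlinarith
      · intro hL
        have he0 : e = 0 := by linarith
        have hLN : L = N := by linarith
        obtain ⟨q1, q2⟩ := p5 hLN
        subst he0
        constructor <;> linarith
    · right
      refine ⟨by nlinarith, fun h => by norm_num at h, fun _ => ⟨by nlinarith, by nlinarith⟩⟩
  · right
    rcases hσ with rfl | rfl <;> rcases hε with rfl | rfl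
    · have := m2 rfl
      refine ⟨by nlinarith, fun _ => by nlinarith, fun h => by norm_num at h⟩
    · have := m2 rfl
      refine ⟨by nlinarith, fun h => by norm_num at h, fun _ => ⟨by nlinarith, by nlinarith⟩⟩
    · obtain ⟨q1, q2⟩ := m3 rfl
      refine ⟨by nlinarith, fun h => by norm_num at h, fun _ => ⟨by nlinarith, by nlinarith⟩⟩
    · obtain ⟨q1, q2⟩ := m3 rfl
      refine ⟨by nlinarith, fun _ => by nlinarith, fun h => by norm_num at h⟩

def M (c : ℤ) : Matrix (Fin 2) (Fin 2) ℤ := !![2 * c, -1; 1, 0]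

lemma sign_split (c : ℤ) (hc : c ≠ 0) :
    ∃ s e : ℤ, (s = 1 ∨ s = -1) ∧ 0 ≤ e ∧ c = s * (e + 1) ∧ |c| = e + 1 := by
  rcases lt_or_gt_of_ne hc with h | h
  · exact ⟨-1, -c - 1, Or.inr rfl, by linarith, by ring, by rw [abs_of_neg h]; ring⟩
  · exact ⟨1, c - 1, Or.inl rfl, by linarith, by ring, by rw [abs_of_pos h]; ring⟩

lemma word_inv (l : List ℤ) : ∀ c : ℤ, (∀ d ∈ c :: l, d ≠ 0) →
    ∃ s r g X Y Z T : ℤ, (s = 1 ∨ s = -1) ∧ (r = 1 ∨ r = -1) ∧ (g = 1 ∨ g = -1) ∧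
      ((c :: l).map M).prod = !![g * X, -(g * r * Z); g * s * Y, -(g * s * r * T)] ∧
      Inv (s * r) X Y Z T (((c :: l).map (fun d => |d|)).sum) ((c :: l).length : ℤ) := by
  induction l with
  | nil =>
    intro c hc
    obtain ⟨s, e, hs, he, h1, h2⟩ := sign_split c (hc c (by simp))
    refine ⟨s, s, s, 2 * (e + 1), 1, 1, 0, hs, hs, hs, ?_, ?_, ?_⟩
    · rcases hs with rfl | rfl <;> simp [M, h1]; ring
    · simp only [Common, List.map, List.sum_cons, List.sum_nil, List.length, h2]
      refine ⟨?_, ?_, ?_, ?_, ?_, ?_, ?_, ?_, ?_, ?_⟩ <;> push_cast <;> linarith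
    · left
      simp only [Pure, List.map, List.sum_cons, List.sum_nil, List.length, h2]
      push_cast
      refine ⟨by rcases hs with rfl | rfl <;> norm_num, ?_, ?_, ?_, ?_, ?_⟩
      · linarith
      · linarith
      · linarith
      · linarith
      · intro h
        constructor <;> linarith
  | cons c' l ih =>
    intro c hc
    obtain ⟨s, r, g, X, Y, Z, T, hs, hr, hg, hP, hI⟩ :=
      ih c' (fun d hd => hc d (List.mem_cons_of_mem _ hd))
    obtain ⟨s', e, hs', he, h1, h2⟩ := sign_split c (hc c (by simp))
    have hε : s * s' = 1 ∨ s * s' = -1 := by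
      rcases hs with rfl | rfl <;> rcases hs' with rfl | rfl <;> norm_num
    have hσ : s * r = 1 ∨ s * r = -1 := by
      rcases hs with rfl | rfl <;> rcases hr with rfl | rfl <;> norm_num
    have hstep := inv_step hσ hε he hI
    refine ⟨s', r, g * s', 2 * (e + 1) * X - s * s' * Y, X, 2 * (e + 1) * Z - s * s' * T, Z,
      hs', hr, ?_, ?_, ?_⟩
    rotate_left 2
    · have e1 : s' * r = s * r * (s * s') := by
        rcases hs with rfl | rfl <;> ring
      rw [e1]
      convert hstep using 1
      · rw [List.map_cons, List.sum_cons, h2]; ring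
      · simp
    · rcases hg with rfl | rfl <;> rcases hs' with rfl | rfl <;> norm_num
    · rw [List.map_cons, List.prod_cons, hP, M, h1, Matrix.mul_fin_two]
      rcases hs with rfl | rfl <;> rcases hs' with rfl | rfl <;>
        (ext i j; fin_cases i <;> fin_cases j <;> simp <;> ring)

lemma word_bound (l : List ℤ) (hl : l ≠ []) (h0 : ∀ d ∈ l, d ≠ 0) (hev : Even l.length)
    (L : ℤ) (hL : L = (l.map (fun d => |d|)).sum)
    (htr : |((l.map M).prod).trace| ≠ 2) :
    2 * L ≤ |((l.map M).prod).trace| ∧ (Even L → 4 * L - 6 ≤ |((l.map M).prod).trace|) := by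
  obtain ⟨c, l, rfl⟩ := List.exists_cons_of_ne_nil hl
  obtain ⟨s, r, g, X, Y, Z, T, hs, hr, hg, hP, hC, hI⟩ := word_inv l c h0
  rw [← hL] at hC hI
  have hN2 : Even (((c :: l).length : ℕ) : ℤ) := by exact_mod_cast hev
  generalize (((c :: l).length : ℕ) : ℤ) = N at *
  have hσ : s * r = 1 ∨ s * r = -1 := by
    rcases hs with rfl | rfl <;> rcases hr with rfl | rfl <;> norm_num
  generalize hσ' : s * r = σ at *
  obtain ⟨h1, h2, h3, h4, h5, h6, h7, h8, h9, h10⟩ := hC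
  have ht : |((c :: l).map M).prod.trace| = X - σ * T := by
    rw [hP, Matrix.trace_fin_two_of]
    have : g * X + -(g * s * r * T) = g * (X - σ * T) := by rw [← hσ']; ring
    rw [this, abs_mul]
    have hg1 : |g| = 1 := by rcases hg with rfl | rfl <;> norm_num
    rw [hg1, one_mul, abs_of_nonneg]
    rcases hσ with rfl | rfl <;> linarith
  rw [ht] at htr ⊢
  rcases hI with ⟨rfl, p1, p2, p3, p4, p5⟩ | ⟨m1, m2, m3⟩
  · have hne : L ≠ N := fun h => htr (by linarith [(p5 h).1])
    have hlt : N + 1 ≤ L := lt_of_le_of_ne h10 (Ne.symm hne)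
    constructor
    · nlinarith [mul_nonneg (show 0 ≤ N - 1 by linarith) (show 0 ≤ L - N - 1 by linarith)]
    · intro hLe
      obtain ⟨u, hu⟩ := hLe
      obtain ⟨v, hv⟩ := hN2
      have b1 : 0 ≤ N - 2 := by omega
      have b2 : 0 ≤ L - N - 2 := by omega
      nlinarith [mul_nonneg b1 b2]
  · constructor
    · linarith
    · intro _
      linarith

def flat : List (ℤ × ℤ) → List ℤ
  | [] => []
  | p :: ps => p.1 :: p.2 :: flat ps

lemma flat_prod (ps : List (ℤ × ℤ)) : ∃ g : ℤ, (g = 1 ∨ g = -1) ∧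
    (ps.map (fun p => !![1, 2 * p.1; 0, 1] * !![(1 : ℤ), 0; -2 * p.2, 1])).prod
      = g • ((flat ps).map M).prod := by
  induction ps with
  | nil => exact ⟨1, Or.inl rfl, by simp [flat]⟩
  | cons p ps ih =>
    obtain ⟨g, hg, h⟩ := ih
    refine ⟨-g, by rcases hg with rfl | rfl <;> norm_num, ?_⟩
    have e : !![1, 2 * p.1; 0, 1] * !![(1 : ℤ), 0; -2 * p.2, 1] = -(M p.1 * M p.2) := by
      ext i j
      fin_cases i <;> fin_cases j <;> simp [M]
    rw [List.map_cons, List.prod_cons, h, e, flat, List.map_cons, List.map_cons, List.prod_cons,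
      List.prod_cons, Matrix.mul_smul, neg_mul, smul_neg, neg_smul, Matrix.mul_assoc]

lemma flat_sum (ps : List (ℤ × ℤ)) :
    ((flat ps).map (fun d => |d|)).sum = (ps.map (fun p => |p.1| + |p.2|)).sum := by
  induction ps with
  | nil => simp [flat]
  | cons p ps ih => simp [flat, ih]; ring

lemma flat_even (ps : List (ℤ × ℤ)) : Even (flat ps).length := by
  induction ps with
  | nil => simp [flat]
  | cons p ps ih =>
    obtain ⟨u, hu⟩ := ih
    exact ⟨u + 1, by simp [flat, hu]; ring⟩

lemma flat_ne (ps : List (ℤ × ℤ)) (h : ∀ p ∈ ps, p.1 ≠ 0 ∧ p.2 ≠ 0) : ∀ d ∈ flat ps, d ≠ 0 := by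
  induction ps with
  | nil => simp [flat]
  | cons p ps ih =>
    intro d hd
    simp only [flat, List.mem_cons] at hd
    rcases hd with rfl | rfl | hd
    · exact (h p (by simp)).1
    · exact (h p (by simp)).2
    · exact ih (fun q hq => h q (by simp [hq])) d hd

end TraceWord

/-- Theorem 3.1: for a word `w = A^{m₁}B^{n₁}⋯A^{m_k}B^{n_k}` in the generators
`A = [[1,2],[0,1]]`, `B = [[1,0],[−2,1]]` of `Γ(2)`, with all exponents nonzero and
length `L = Σ (|m_j| + |n_j|)`, if `|tr w| ≠ 2` then `|tr w| ≥ 2L`, and moreover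
`|tr w| ≥ 4L − 6` when `L` is even. -/
theorem trace_word_length_bound
    (k : ℕ) (hk : 1 ≤ k) (m n : Fin k → ℤ)
    (hm : ∀ j, m j ≠ 0) (hn : ∀ j, n j ≠ 0)
    (w : Matrix (Fin 2) (Fin 2) ℤ)
    (hw : w = (List.ofFn (fun j : Fin k =>
        !![1, 2 * m j; 0, 1] * !![(1 : ℤ), 0; -2 * n j, 1])).prod)
    (L : ℤ) (hL : L = ∑ j, (|m j| + |n j|))
    (htr : |Matrix.trace w| ≠ 2) :
    2 * L ≤ |Matrix.trace w| ∧ (Even L → 4 * L - 6 ≤ |Matrix.trace w|) := by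
  obtain ⟨ps, hps⟩ : ∃ ps, ps = List.ofFn (fun j : Fin k => (m j, n j)) := ⟨_, rfl⟩
  obtain ⟨g, hg, h⟩ := TraceWord.flat_prod ps
  have hw' : w = g • ((TraceWord.flat ps).map TraceWord.M).prod := by
    rw [← h, hw, hps, List.map_ofFn]
    rfl
  have ht : |Matrix.trace w| = |(((TraceWord.flat ps).map TraceWord.M).prod).trace| := by
    rw [hw', Matrix.trace_smul, smul_eq_mul, abs_mul]
    rcases hg with rfl | rfl <;> simp
  rw [ht] at htr ⊢
  refine TraceWord.word_bound _ ?_ (TraceWord.flat_ne ps ?_) (TraceWord.flat_even ps) L ?_ htr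
  · intro h0
    obtain ⟨k, rfl⟩ : ∃ k', k = k' + 1 := ⟨k - 1, by omega⟩
    rw [hps, List.ofFn_succ] at h0
    simp [TraceWord.flat] at h0
  · intro p hp
    rw [hps, List.mem_ofFn] at hp
    obtain ⟨j, rfl⟩ := hp
    exact ⟨hm j, hn j⟩
  · rw [TraceWord.flat_sum, hps, List.map_ofFn, List.sum_ofFn, hL]
    rfl
end

section
/- Let M = [[a,b],[c,d]] be an integer matrix with determinant ad − bc = 1 such that a and d are odd and b and c are even (i.e. M belongs to the principal congruence subgroup Γ(2) of level 2 in SL(2,ℤ)). If |a + d| ≠ 2 (i.e. M is not parabolic and not ± the identity), then |a + d| ≥ 6. -/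
/-- Lemma 2.1: a matrix `M = [[a,b],[c,d]] ∈ Γ(2)` (determinant `1`, `a, d` odd,
`b, c` even) which is not parabolic, i.e. `|tr M| = |a + d| ≠ 2`, satisfies
`|a + d| ≥ 6`. -/
theorem gamma2_trace_ge_six
    (a b c d : ℤ) (hdet : a * d - b * c = 1)
    (ha : Odd a) (hd : Odd d) (hb : Even b) (hc : Even c)
    (htr : |a + d| ≠ 2) :
    6 ≤ |a + d| := by
  obtain ⟨k, rfl⟩ := ha
  obtain ⟨l, rfl⟩ := hd
  obtain ⟨m, rfl⟩ := hb
  obtain ⟨n, rfl⟩ := hc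
  have h : k + l = 2 * (m * n - k * l) := by linarith
  generalize m * n - k * l = t at h
  clear hdet
  rcases abs_cases (2 * k + 1 + (2 * l + 1)) with ⟨h1, h2⟩ | ⟨h1, h2⟩ <;>
    rw [h1] at htr ⊢ <;> omega
end

section
/- Let X = [[a,b],[c,d]] be an integer matrix with ad − bc = 1, a and d odd, b and c even, which is decreasing, i.e. |a| > |b| > |d| and |a| > |c| > |d|. Then τ(X) := |a| − |b| − |c| + |d| ≥ 0. Moreover, if τ(X) = 0, then there exist a positive integer k and signs δ, ε ∈ {1, −1} such that X = δ · [[2k+1, 2εk],[−2εk, −(2k−1)]]; in particular τ(X) = 0 implies |a + d| = 2. -/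
/-- Lemma 3.1: for a decreasing matrix `X = [[a,b],[c,d]] ∈ Γ(2)` (that is,
`|a| > |b| > |d|` and `|a| > |c| > |d|`), one has `τ(X) = |a| − |b| − |c| + |d| ≥ 0`;
and if `τ(X) = 0` then `X = ± [[2k+1, ±2k],[∓2k, −(2k−1)]]` for some `k ∈ ℕ`, `k ≥ 1`,
so in particular `|tr X| = 2`. -/
theorem decreasing_tau_nonneg
    (a b c d : ℤ) (hdet : a * d - b * c = 1)
    (ha : Odd a) (hd : Odd d) (hb : Even b) (hc : Even c)
    (h1 : |b| < |a|) (h2 : |d| < |b|) (h3 : |c| < |a|) (h4 : |d| < |c|) :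
    0 ≤ |a| - |b| - |c| + |d| ∧
    (|a| - |b| - |c| + |d| = 0 →
      (∃ k : ℕ, 0 < k ∧ ∃ δ ε : ℤ, (δ = 1 ∨ δ = -1) ∧ (ε = 1 ∨ ε = -1) ∧
        !![a, b; c, d] =
          δ • !![2 * (k : ℤ) + 1, 2 * ε * (k : ℤ);
                 -(2 * ε * (k : ℤ)), -(2 * (k : ℤ) - 1)]) ∧
      |a + d| = 2) := by
  have hdpos : 0 < |d| := by
    apply abs_pos.mpr
    rintro rfl
    exact absurd hd (by decide)
  have hk : |a| * |d| - |b| * |c| = 1 ∧ a * d = |a| * |d| ∧ b * c = |b| * |c| ∨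
      |a| * |d| - |b| * |c| = -1 ∧ a * d = -(|a| * |d|) ∧ b * c = -(|b| * |c|) := by
    have hAD : 0 < |a| * |d| := mul_pos (by omega) hdpos
    have hBC : 0 < |b| * |c| := mul_pos (by omega) (by omega)
    rw [← abs_mul, ← abs_mul] at *
    rcases abs_cases (a * d) with h | h <;> rcases abs_cases (b * c) with h' | h' <;> omega
  have hid : (|a| - |b| - |c| + |d|) * |d|
      = (|b| - |d|) * (|c| - |d|) + (|a| * |d| - |b| * |c|) := by ring
  have hxy : 1 ≤ (|b| - |d|) * (|c| - |d|) := by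
    have := mul_pos (sub_pos.mpr h2) (sub_pos.mpr h4)
    omega
  refine ⟨?_, ?_⟩
  · by_contra hneg
    push Not at hneg
    have := mul_neg_of_neg_of_pos hneg hdpos
    omega
  · intro h0
    rw [h0, zero_mul] at hid
    obtain ⟨-, had, hbc⟩ : |a| * |d| - |b| * |c| = -1 ∧ a * d = -(|a| * |d|) ∧
        b * c = -(|b| * |c|) := by
      rcases hk with h | h
      · omega
      · exact h
    have hx1 : (|b| - |d|) * (|c| - |d|) = 1 := by omega
    have hx : |b| - |d| = 1 := by
      rcases Int.mul_eq_one_iff_eq_one_or_neg_one.mp hx1 with h | h <;> omega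
    have hy : |c| - |d| = 1 := by
      rcases Int.mul_eq_one_iff_eq_one_or_neg_one.mp hx1 with h | h <;> omega
    have hA : |a| = |d| + 2 := by omega
    have hB : |b| = |d| + 1 := by omega
    have hC : |c| = |d| + 1 := by omega
    have had' : a * d < 0 := by
      have : 0 < |a| * |d| := mul_pos (by omega) hdpos
      omega
    have hbc' : b * c < 0 := by
      have : 0 < |b| * |c| := mul_pos (by omega) (by omega)
      omega
    obtain ⟨m, hm⟩ : Odd |d| := odd_abs.mpr hd
    rw [hm] at hA hB hC
    have hm0 : 0 ≤ m := by omega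
    lift m to ℕ using hm0
    have key : ∃ δ ε : ℤ, (δ = 1 ∨ δ = -1) ∧ (ε = 1 ∨ ε = -1) ∧
        a = δ * (2 * m + 3) ∧ d = -(δ * (2 * m + 1)) ∧ b = δ * ε * (2 * m + 2) ∧
        c = -(δ * ε * (2 * m + 2)) := by
      rcases mul_neg_iff.mp had' with ⟨p, q⟩ | ⟨p, q⟩ <;>
      rcases mul_neg_iff.mp hbc' with ⟨r, s⟩ | ⟨r, s⟩ <;>
      simp only [abs_of_pos, abs_of_neg, p, q, r, s] at hA hB hC hm
      · exact ⟨1, 1, by omega⟩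
      · exact ⟨1, -1, by omega⟩
      · exact ⟨-1, -1, by omega⟩
      · exact ⟨-1, 1, by omega⟩
    obtain ⟨δ, ε, hδ, hε, e1, e2, e3, e4⟩ := key
    refine ⟨⟨m + 1, by omega, δ, ε, hδ, hε, ?_⟩, ?_⟩
    · rw [e1, e2, e3, e4]
      ext i j
      fin_cases i <;> fin_cases j <;> simp [-mul_eq_mul_left_iff] <;> ring
    · have : a + d = δ * 2 := by rw [e1, e2]; ring
      rw [this]
      rcases hδ with rfl | rfl <;> norm_num
end

section
/- Let X = [[a,b],[c,d]] be an integer matrix with ad − bc = 1, a and d odd, b and c even, which is decreasing (|a| > |b| > |d| and |a| > |c| > |d|). Let m, n be nonzero integers and set Y = [[1−4mn, 2m],[−2n, 1]] · X. Then Y is decreasing, and τ(Y) ≥ (4|mn| − 2|n| − 1)·τ(X) ≥ τ(X). -/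
theorem core_pos (A B C D M N e f : ℤ) (hD : 0 < D) (h1 : B < A) (h2 : D < B) (h3 : C < A)
    (h4 : D < C) (ht : 0 ≤ A - B - C + D) (hM : 1 ≤ M) (hN : 1 ≤ N)
    (he : e = 1 ∨ e = -1) (hf : f = 1 ∨ f = -1) (P Q R S : ℤ)
    (hP : P = (4 * M * N + e) * A - f * (2 * M * C)) (hQ : Q = (4 * M * N + e) * B - f * (2 * M * D))
    (hR : R = 2 * N * A - f * C) (hS : S = 2 * N * B - f * D) :
    (|Q| < |P| ∧ |S| < |Q| ∧ |R| < |P| ∧ |S| < |R|) ∧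
    (4 * (M * N) - 2 * N - 1) * (A - B - C + D) ≤ |P| - |Q| - |R| + |S| ∧
    A - B - C + D ≤ (4 * (M * N) - 2 * N - 1) * (A - B - C + D) := by
  obtain ⟨x, rfl⟩ : ∃ x, M = x + 1 := ⟨M - 1, by ring⟩
  obtain ⟨y, rfl⟩ : ∃ y, N = y + 1 := ⟨N - 1, by ring⟩
  obtain ⟨p, rfl⟩ : ∃ p, B = D + p := ⟨B - D, by ring⟩
  obtain ⟨q, rfl⟩ : ∃ q, C = D + q := ⟨C - D, by ring⟩
  obtain ⟨t, rfl⟩ : ∃ t, A = D + p + q + t := ⟨A - D - p - q, by ring⟩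
  have hx : 0 ≤ x := by linarith
  have hy : 0 ≤ y := by linarith
  have hp : 0 < p := by linarith
  have hq : 0 < q := by linarith
  have ht : 0 ≤ t := by linarith
  have hxy := mul_nonneg hx hy
  have hS0 : 0 < S := by
    rcases hf with rfl | rfl <;> nlinarith [mul_nonneg hy hD.le, mul_nonneg hy hp.le]
  have e1 := mul_nonneg hxy hD.le
  have e2 := mul_nonneg hxy hp.le
  have e3 := mul_nonneg hxy hq.le
  have e4 := mul_nonneg hxy ht
  have e5 := mul_nonneg hx hD.le
  have e6 := mul_nonneg hx hp.le
  have e7 := mul_nonneg hx hq.le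
  have e8 := mul_nonneg hx ht
  have f5 := mul_nonneg hy hD.le
  have f6 := mul_nonneg hy hp.le
  have f7 := mul_nonneg hy hq.le
  have f8 := mul_nonneg hy ht
  have hSR : S < R := by rcases hf with rfl | rfl <;> linarith
  have hSQ : S < Q := by rcases hf with rfl | rfl <;> rcases he with rfl | rfl <;> linarith
  have hQP : Q < P := by rcases hf with rfl | rfl <;> rcases he with rfl | rfl <;> linarith
  have hRP : R < P := by rcases hf with rfl | rfl <;> rcases he with rfl | rfl <;> linarith
  rw [abs_of_pos hS0, abs_of_pos (hS0.trans hSR), abs_of_pos (hS0.trans hSQ),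
    abs_of_pos ((hS0.trans hSQ).trans hQP)]
  refine ⟨⟨hQP, hSQ, hRP, hSR⟩, ?_, ?_⟩
  · rcases hf with rfl | rfl <;> rcases he with rfl | rfl <;> linarith
  · linarith

theorem core (A B C D m n : ℤ) (hD : 0 < D) (h1 : B < A) (h2 : D < B) (h3 : C < A)
    (h4 : D < C) (ht : 0 ≤ A - B - C + D) (hm : m ≠ 0) (hn : n ≠ 0) (P Q R S : ℤ)
    (hP : |P| = |(1 - 4 * m * n) * A + 2 * m * C|) (hQ : |Q| = |(1 - 4 * m * n) * B + 2 * m * D|)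
    (hR : |R| = |-2 * n * A + C|) (hS : |S| = |-2 * n * B + D|) :
    (|Q| < |P| ∧ |S| < |Q| ∧ |R| < |P| ∧ |S| < |R|) ∧
    (4 * |m * n| - 2 * |n| - 1) * (A - B - C + D) ≤ |P| - |Q| - |R| + |S| ∧
    A - B - C + D ≤ (4 * |m * n| - 2 * |n| - 1) * (A - B - C + D) := by
  rw [abs_mul, hP, hQ, hR, hS]
  rcases lt_or_gt_of_ne hm with hm | hm <;> rcases lt_or_gt_of_ne hn with hn | hn
  · rw [abs_of_neg hm, abs_of_neg hn, ← abs_neg ((1 - 4 * m * n) * A + 2 * m * C),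
      ← abs_neg ((1 - 4 * m * n) * B + 2 * m * D)]
    exact core_pos A B C D (-m) (-n) (-1) (-1) hD h1 h2 h3 h4 ht (by linarith) (by linarith)
      (by simp) (by simp) _ _ _ _ (by ring) (by ring) (by ring) (by ring)
  · rw [abs_of_neg hm, abs_of_pos hn, ← abs_neg (-2 * n * A + C), ← abs_neg (-2 * n * B + D)]
    exact core_pos A B C D (-m) n 1 1 hD h1 h2 h3 h4 ht (by linarith) (by linarith)
      (by simp) (by simp) _ _ _ _ (by ring) (by ring) (by ring) (by ring)
  · rw [abs_of_pos hm, abs_of_neg hn]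
    exact core_pos A B C D m (-n) 1 (-1) hD h1 h2 h3 h4 ht (by linarith) (by linarith)
      (by simp) (by simp) _ _ _ _ (by ring) (by ring) (by ring) (by ring)
  · rw [abs_of_pos hm, abs_of_pos hn, ← abs_neg ((1 - 4 * m * n) * A + 2 * m * C),
      ← abs_neg ((1 - 4 * m * n) * B + 2 * m * D), ← abs_neg (-2 * n * A + C),
      ← abs_neg (-2 * n * B + D)]
    exact core_pos A B C D m n (-1) 1 hD h1 h2 h3 h4 ht (by linarith) (by linarith)
      (by simp) (by simp) _ _ _ _ (by ring) (by ring) (by ring) (by ring)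

theorem abs_comb (s e x y u v : ℤ) (hs : |s| = 1) (he : e * e = 1) :
    |u * (s * x) + v * (s * e * y)| = |u * x + (e * v) * y| := by
  rw [show u * (s * x) + v * (s * e * y) = s * (u * x + (e * v) * y) by ring, abs_mul, hs, one_mul]

/-- sign normal form -/
theorem signs (a b c d : ℤ) (hdet : a * d - b * c = 1) (hd : d ≠ 0)
    (h1 : |b| < |a|) (h2 : |d| < |b|) (h3 : |c| < |a|) (h4 : |d| < |c|) :
    ∃ s t e : ℤ, |s| = 1 ∧ |t| = 1 ∧ (e = 1 ∨ e = -1) ∧ a = s * |a| ∧ c = s * e * |c| ∧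
      b = t * |b| ∧ d = t * e * |d| := by
  have hD : 0 < |d| := abs_pos.mpr hd
  rcases abs_cases a with ⟨p1, q1⟩ | ⟨p1, q1⟩ <;> rcases abs_cases b with ⟨p2, q2⟩ | ⟨p2, q2⟩ <;>
  rcases abs_cases c with ⟨p3, q3⟩ | ⟨p3, q3⟩ <;> rcases abs_cases d with ⟨p4, q4⟩ | ⟨p4, q4⟩ <;>
  simp only [p1, p2, p3, p4] at h1 h2 h3 h4 hD ⊢ <;>
  first
  | (refine ⟨1, 1, 1, ?_⟩; norm_num; done)
  | (refine ⟨1, 1, -1, ?_⟩; norm_num; done)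
  | (refine ⟨1, -1, 1, ?_⟩; norm_num; done)
  | (refine ⟨1, -1, -1, ?_⟩; norm_num; done)
  | (refine ⟨-1, 1, 1, ?_⟩; norm_num; done)
  | (refine ⟨-1, 1, -1, ?_⟩; norm_num; done)
  | (refine ⟨-1, -1, 1, ?_⟩; norm_num; done)
  | (refine ⟨-1, -1, -1, ?_⟩; norm_num; done)
  | (exfalso; nlinarith)


/-- Lemma 3.2, inequality (3.4): if `X = [[a,b],[c,d]] ∈ Γ(2)` is decreasing
(`|a| > |b| > |d|`, `|a| > |c| > |d|`) and `m, n` are nonzero integers, then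
`Y = A^m B^n X = [[1−4mn, 2m],[−2n, 1]]·X` is decreasing and
`τ(Y) ≥ (4|mn| − 2|n| − 1)·τ(X) ≥ τ(X)`. -/
theorem decreasing_step_tau
    (a b c d : ℤ) (hdet : a * d - b * c = 1)
    (ha : Odd a) (hd : Odd d) (hb : Even b) (hc : Even c)
    (h1 : |b| < |a|) (h2 : |d| < |b|) (h3 : |c| < |a|) (h4 : |d| < |c|)
    (m n : ℤ) (hm : m ≠ 0) (hn : n ≠ 0)
    (Y : Matrix (Fin 2) (Fin 2) ℤ)
    (hY : Y = !![1 - 4 * m * n, 2 * m; -2 * n, 1] * !![a, b; c, d]) :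
    (|Y 0 1| < |Y 0 0| ∧ |Y 1 1| < |Y 0 1| ∧ |Y 1 0| < |Y 0 0| ∧ |Y 1 1| < |Y 1 0|) ∧
    (4 * |m * n| - 2 * |n| - 1) * (|a| - |b| - |c| + |d|) ≤
      |Y 0 0| - |Y 0 1| - |Y 1 0| + |Y 1 1| ∧
    |a| - |b| - |c| + |d| ≤ (4 * |m * n| - 2 * |n| - 1) * (|a| - |b| - |c| + |d|) := by
  have hd0 : d ≠ 0 := by rintro rfl; simp at hd
  obtain ⟨s, t, e, hs, ht, he, ea, ec, eb, ed⟩ := signs a b c d hdet hd0 h1 h2 h3 h4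
  have hD : 0 < |d| := abs_pos.mpr hd0
  have hee : e * e = 1 := by rcases he with rfl | rfl <;> norm_num
  have he0 : e ≠ 0 := by rintro rfl; simp at hee
  have hea : |e| = 1 := by rcases he with rfl | rfl <;> norm_num
  have hdet' : |(|a| * |d| - |b| * |c|)| = 1 := by
    have : s * t * e * (|a| * |d| - |b| * |c|) = 1 := by
      rw [← hdet]
      linear_combination (-d) * ea - s * |a| * ed + c * eb + t * |b| * ec
    have h := congrArg abs this
    simpa [abs_mul, hs, ht, hea] using h
  have hτ : 0 ≤ |a| - |b| - |c| + |d| := by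
    have h := neg_le_of_abs_le hdet'.le
    have h5 : 1 ≤ (|b| - |d|) * (|c| - |d|) := by nlinarith
    by_contra hneg
    have h6 : |a| - |b| - |c| + |d| ≤ -1 := by omega
    nlinarith
  have k00 : Y 0 0 = (1 - 4 * m * n) * a + 2 * m * c := by simp [hY, Matrix.mul_apply]
  have k01 : Y 0 1 = (1 - 4 * m * n) * b + 2 * m * d := by simp [hY, Matrix.mul_apply]
  have k10 : Y 1 0 = -2 * n * a + 1 * c := by simp [hY, Matrix.mul_apply]
  have k11 : Y 1 1 = -2 * n * b + 1 * d := by simp [hY, Matrix.mul_apply]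
  have main := core |a| |b| |c| |d| (e * m) (e * n) hD h1 h2 h3 h4 hτ
    (mul_ne_zero he0 hm) (mul_ne_zero he0 hn) (Y 0 0) (Y 0 1) (Y 1 0) (Y 1 1)
    (by
      have h := abs_comb s e |a| |c| (1 - 4 * m * n) (2 * m) hs hee
      rw [← ea, ← ec] at h
      rw [k00, h]; congr 1; linear_combination 4 * m * n * |a| * hee)
    (by
      have h := abs_comb t e |b| |d| (1 - 4 * m * n) (2 * m) ht hee
      rw [← eb, ← ed] at h
      rw [k01, h]; congr 1; linear_combination 4 * m * n * |b| * hee)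
    (by
      have h := abs_comb s e |a| |c| (-2 * n) 1 hs hee
      rw [← ea, ← ec] at h
      have g : -2 * n * |a| + e * 1 * |c| = e * (-2 * (e * n) * |a| + |c|) := by
        linear_combination 2 * n * |a| * hee
      rw [k10, h, g, abs_mul, hea, one_mul])
    (by
      have h := abs_comb t e |b| |d| (-2 * n) 1 ht hee
      rw [← eb, ← ed] at h
      have g : -2 * n * |b| + e * 1 * |d| = e * (-2 * (e * n) * |b| + |d|) := by
        linear_combination 2 * n * |b| * hee
      rw [k11, h, g, abs_mul, hea, one_mul])
  have z1 : |e * m * (e * n)| = |m * n| := by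
    congr 1; linear_combination m * n * hee
  have z2 : |e * n| = |n| := by rw [abs_mul, hea, one_mul]
  rw [z1, z2] at main
  exact main
end

section
/- Let X = [[a,b],[c,d]] be an integer matrix with ad − bc = 1, a and d odd, b and c even, which is decreasing (|a| > |b| > |d| and |a| > |c| > |d|). Let m, n be nonzero integers and set Y = [[1−4mn, 2m],[−2n, 1]] · X. Then |tr Y| ≥ |tr X| + τ(X)·(|m| + |n|). -/
/-- Lemma 3.2, inequality (3.5): if `X = [[a,b],[c,d]] ∈ Γ(2)` is decreasing
(`|a| > |b| > |d|`, `|a| > |c| > |d|`) and `m, n` are nonzero integers, then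
`Y = A^m B^n X = [[1−4mn, 2m],[−2n, 1]]·X` satisfies
`|tr Y| ≥ |tr X| + τ(X)·(|m| + |n|)`. -/
theorem decreasing_step_trace
    (a b c d : ℤ) (hdet : a * d - b * c = 1)
    (ha : Odd a) (hd : Odd d) (hb : Even b) (hc : Even c)
    (h1 : |b| < |a|) (h2 : |d| < |b|) (h3 : |c| < |a|) (h4 : |d| < |c|)
    (m n : ℤ) (hm : m ≠ 0) (hn : n ≠ 0)
    (Y : Matrix (Fin 2) (Fin 2) ℤ)
    (hY : Y = !![1 - 4 * m * n, 2 * m; -2 * n, 1] * !![a, b; c, d]) :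
    |a + d| + (|a| - |b| - |c| + |d|) * (|m| + |n|) ≤ |Matrix.trace Y| := by
  have hd0 : d ≠ 0 := by
    rintro rfl
    simp at hd
  have hD : 0 < |d| := abs_pos.mpr hd0
  have hP : 0 ≤ |m| - 1 := by have := abs_pos.mpr hm; omega
  have hQ : 0 ≤ |n| - 1 := by have := abs_pos.mpr hn; omega
  have htr : Matrix.trace Y = a + d - 4 * m * n * a + 2 * m * c - 2 * n * b := by
    subst hY
    simp [Matrix.trace_fin_two]
    ring
  rw [htr]
  have t1 := le_abs_self (a + d - 4 * m * n * a + 2 * m * c - 2 * n * b)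
  have t2 := neg_le_abs (a + d - 4 * m * n * a + 2 * m * c - 2 * n * b)
  generalize |a + d - 4 * m * n * a + 2 * m * c - 2 * n * b| = T at *
  have hA : 0 < |a| := by omega
  have hB : 0 < |b| := by omega
  have hC : 0 < |c| := by omega
  have e1 := mul_pos hB hC
  have e2 : 1 < |a| * |d| := by nlinarith
  have p0 := mul_nonneg (mul_nonneg hP hQ) hA.le
  have p1 := mul_nonneg hP (sub_nonneg.mpr h1.le)
  have p2 := mul_nonneg hP (sub_nonneg.mpr h2.le)
  have p3 := mul_nonneg hP (sub_nonneg.mpr h3.le)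
  have p4 := mul_nonneg hP (sub_nonneg.mpr h4.le)
  have p5 := mul_nonneg hP hD.le
  have q1 := mul_nonneg hQ (sub_nonneg.mpr h1.le)
  have q2 := mul_nonneg hQ (sub_nonneg.mpr h2.le)
  have q3 := mul_nonneg hQ (sub_nonneg.mpr h3.le)
  have q4 := mul_nonneg hQ (sub_nonneg.mpr h4.le)
  have q5 := mul_nonneg hQ hD.le
  clear htr hY ha hd hb hc hm hn hd0
  rcases abs_cases a with ⟨ea, _⟩ | ⟨ea, _⟩ <;> rcases abs_cases d with ⟨ed, _⟩ | ⟨ed, _⟩ <;>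
  rcases abs_cases b with ⟨eb, _⟩ | ⟨eb, _⟩ <;> rcases abs_cases c with ⟨ec, _⟩ | ⟨ec, _⟩ <;>
  rw [ea, ed] at e2 <;> rw [eb, ec] at e1 <;> first
  | (exfalso; linarith)
  | (rcases abs_cases (a + d) with ⟨es, _⟩ | ⟨es, _⟩ <;>
     rcases abs_cases m with ⟨em, _⟩ | ⟨em, _⟩ <;> rcases abs_cases n with ⟨en, _⟩ | ⟨en, _⟩ <;>
     simp only [ea, ed, eb, ec, em, en, es] at * <;> first
     | (exfalso; linarith)
     | linarith)
end

section
/- Let X = [[a,b],[c,d]] be an integer matrix with ad − bc = 1, a and d odd, b and c even, which is decreasing (|a| > |b| > |d| and |a| > |c| > |d|), and assume in addition that ad > 0. Let m, n be nonzero integers and set Y = [[1−4mn, 2m],[−2n, 1]] · X. Then |tr Y| ≥ |tr X| + (τ(X) + 2)·(|m| + |n|). -/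
lemma core_pos_s13 (a b c d : ℤ) (hd : 0 < d) (h1 : b < a) (h2 : d < b) (h3 : c < a) (h4 : d < c)
    (m n : ℤ) (hm : m ≠ 0) (hn : n ≠ 0) :
    a + d + ((a - b - c + d) + 2) * (|m| + |n|) ≤
      |(1 - 4 * m * n) * a + 2 * m * c - 2 * n * b + d| := by
  rcases lt_or_gt_of_ne hm with hm | hm <;> rcases lt_or_gt_of_ne hn with hn | hn
  · rw [abs_of_neg hm, abs_of_neg hn]
    refine le_trans ?_ (neg_le_abs _)
    obtain ⟨p, rfl⟩ : ∃ p, m = -1 - p := ⟨-1 - m, by ring⟩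
    obtain ⟨q, rfl⟩ : ∃ q, n = -1 - q := ⟨-1 - n, by ring⟩
    have hp : 0 ≤ p := by linarith
    have hq : 0 ≤ q := by linarith
    have e1 := mul_nonneg (mul_nonneg hp hq) (show 0 ≤ a by linarith)
    have e2 := mul_nonneg hp (show 0 ≤ 4 * a + 2 * c - (a - b - c + d + 2) by linarith)
    have e3 := mul_nonneg hq (show 0 ≤ 4 * a - 2 * b - (a - b - c + d + 2) by linarith)
    nlinarith
  · rw [abs_of_neg hm, abs_of_pos hn]
    refine le_trans ?_ (le_abs_self _)
    obtain ⟨p, rfl⟩ : ∃ p, m = -1 - p := ⟨-1 - m, by ring⟩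
    obtain ⟨q, rfl⟩ : ∃ q, n = 1 + q := ⟨n - 1, by ring⟩
    have hp : 0 ≤ p := by linarith
    have hq : 0 ≤ q := by linarith
    have e1 := mul_nonneg (mul_nonneg hp hq) (show 0 ≤ a by linarith)
    have e2 := mul_nonneg hp (show 0 ≤ 4 * a - 2 * c - (a - b - c + d + 2) by linarith)
    have e3 := mul_nonneg hq (show 0 ≤ 4 * a - 2 * b - (a - b - c + d + 2) by linarith)
    nlinarith
  · rw [abs_of_pos hm, abs_of_neg hn]
    refine le_trans ?_ (le_abs_self _)
    obtain ⟨p, rfl⟩ : ∃ p, m = 1 + p := ⟨m - 1, by ring⟩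
    obtain ⟨q, rfl⟩ : ∃ q, n = -1 - q := ⟨-1 - n, by ring⟩
    have hp : 0 ≤ p := by linarith
    have hq : 0 ≤ q := by linarith
    have e1 := mul_nonneg (mul_nonneg hp hq) (show 0 ≤ a by linarith)
    have e2 := mul_nonneg hp (show 0 ≤ 4 * a + 2 * c - (a - b - c + d + 2) by linarith)
    have e3 := mul_nonneg hq (show 0 ≤ 4 * a + 2 * b - (a - b - c + d + 2) by linarith)
    nlinarith
  · rw [abs_of_pos hm, abs_of_pos hn]
    refine le_trans ?_ (neg_le_abs _)
    obtain ⟨p, rfl⟩ : ∃ p, m = 1 + p := ⟨m - 1, by ring⟩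
    obtain ⟨q, rfl⟩ : ∃ q, n = 1 + q := ⟨n - 1, by ring⟩
    have hp : 0 ≤ p := by linarith
    have hq : 0 ≤ q := by linarith
    have e1 := mul_nonneg (mul_nonneg hp hq) (show 0 ≤ a by linarith)
    have e2 := mul_nonneg hp (show 0 ≤ 4 * a - 2 * c - (a - b - c + d + 2) by linarith)
    have e3 := mul_nonneg hq (show 0 ≤ 4 * a + 2 * b - (a - b - c + d + 2) by linarith)
    nlinarith

/-- Lemma 3.2, inequality (3.6): if `X = [[a,b],[c,d]] ∈ Γ(2)` is decreasing
(`|a| > |b| > |d|`, `|a| > |c| > |d|`) with `ad > 0`, and `m, n` are nonzero integers,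
then `Y = A^m B^n X = [[1−4mn, 2m],[−2n, 1]]·X` satisfies
`|tr Y| ≥ |tr X| + (τ(X) + 2)·(|m| + |n|)`. -/
theorem decreasing_step_trace_ad_pos
    (a b c d : ℤ) (hdet : a * d - b * c = 1)
    (ha : Odd a) (hd : Odd d) (hb : Even b) (hc : Even c)
    (h1 : |b| < |a|) (h2 : |d| < |b|) (h3 : |c| < |a|) (h4 : |d| < |c|)
    (had : 0 < a * d)
    (m n : ℤ) (hm : m ≠ 0) (hn : n ≠ 0)
    (Y : Matrix (Fin 2) (Fin 2) ℤ)
    (hY : Y = !![1 - 4 * m * n, 2 * m; -2 * n, 1] * !![a, b; c, d]) :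
    |a + d| + ((|a| - |b| - |c| + |d|) + 2) * (|m| + |n|) ≤ |Matrix.trace Y| := by
  have htr : Matrix.trace Y = (1 - 4 * m * n) * a + 2 * m * c - 2 * n * b + d := by
    rw [hY, Matrix.trace_fin_two]
    simp [Matrix.mul_apply, Fin.sum_univ_two]
    ring
  rw [htr]
  have hb0 : b ≠ 0 := by
    rintro rfl
    simp at h2
    exact absurd h2 (not_lt.mpr (abs_nonneg d))
  have hc0 : c ≠ 0 := by
    rintro rfl
    simp at h4
    exact absurd h4 (not_lt.mpr (abs_nonneg d))
  have hbc : 0 < b * c := lt_of_le_of_ne (by linarith) (mul_ne_zero hb0 hc0).symm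
  have hd0 : d ≠ 0 := by
    rintro rfl
    simp at had
  have key := core_pos_s13 |a| |b| |c| |d| (abs_pos.mpr hd0) h1 h2 h3 h4
  have hm' := neg_ne_zero.mpr hm
  have hn' := neg_ne_zero.mpr hn
  rcases pos_and_pos_or_neg_and_neg_of_mul_pos had with ⟨pa, pd⟩ | ⟨pa, pd⟩ <;>
    rcases pos_and_pos_or_neg_and_neg_of_mul_pos hbc with ⟨pb, pc⟩ | ⟨pb, pc⟩
  · have k := key m n hm hn
    simp only [abs_of_pos pa, abs_of_pos pb, abs_of_pos pc, abs_of_pos pd] at k ⊢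
    rwa [abs_of_pos (add_pos pa pd)]
  · have k := key (-m) (-n) hm' hn'
    simp only [abs_of_pos pa, abs_of_neg pb, abs_of_neg pc, abs_of_pos pd, abs_neg] at k ⊢
    rw [abs_of_pos (add_pos pa pd)]
    convert k using 2
    ring
  · have k := key (-m) (-n) hm' hn'
    simp only [abs_of_neg pa, abs_of_pos pb, abs_of_pos pc, abs_of_neg pd, abs_neg] at k ⊢
    rw [abs_of_neg (add_neg pa pd), ← abs_neg ((1 - 4 * m * n) * a + _ - _ + _), neg_add]
    convert k using 2
    ring
  · have k := key m n hm hn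
    simp only [abs_of_neg pa, abs_of_neg pb, abs_of_neg pc, abs_of_neg pd] at k ⊢
    rw [abs_of_neg (add_neg pa pd), ← abs_neg ((1 - 4 * m * n) * a + _ - _ + _), neg_add]
    convert k using 2
    ring
end

section
/- Let X = [[a,b],[c,d]] be an integer matrix with ad − bc = 1, a and d odd, b and c even, which is decreasing (|a| > |b| > |d| and |a| > |c| > |d|), with ad > 0. Let m, n be nonzero integers with mn > 0 and set Y = [[1−4mn, 2m],[−2n, 1]] · X. If the two diagonal entries of Y have opposite signs (i.e. Y₁₁ · Y₂₂ < 0), then τ(Y) ≥ τ(X) + 2. -/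
theorem tau_key (a b c d m n : ℤ) (hd : 0 < d) (h1 : b < a) (h2 : d < b) (h3 : c < a)
    (h4 : d < c) (hmn : 0 < m * n)
    (hdiag : ((1 - 4 * m * n) * a + 2 * m * c) * (-2 * n * b + d) < 0) :
    (a - b - c + d) + 2 ≤ |(1 - 4 * m * n) * a + 2 * m * c| - |(1 - 4 * m * n) * b + 2 * m * d|
      - |-2 * n * a + c| + |-2 * n * b + d| := by
  rcases lt_or_gt_of_ne (show n ≠ 0 by rintro rfl; simp at hmn) with hn | hn
  · have hm : m < 0 := by
      by_contra h
      nlinarith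
    obtain ⟨k, rfl⟩ : ∃ k, n = -1 - k := ⟨-1 - n, by ring⟩
    obtain ⟨l, rfl⟩ : ∃ l, m = -1 - l := ⟨-1 - m, by ring⟩
    have hk : 0 ≤ k := by linarith
    have hl : 0 ≤ l := by linarith
    have hkl := mul_nonneg hk hl
    have f : ∀ x y : ℤ, 0 < y → y < x → 0 ≤ k * x ∧ 0 ≤ l * y ∧ 0 ≤ l * x ∧ 0 ≤ k * l * x := by
      intro x y hy hx
      have : 0 ≤ x := by linarith
      refine ⟨by positivity, by positivity, by positivity, by positivity⟩
    obtain ⟨p1, p2, p3, p4⟩ := f a b (by linarith) h1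
    obtain ⟨q1, q2, q3, q4⟩ := f b d (by linarith) h2
    obtain ⟨r1, r2, r3, r4⟩ := f c d (by linarith) h4
    rw [abs_of_nonpos (a := (1 - 4 * (-1 - l) * (-1 - k)) * a + 2 * (-1 - l) * c) (by linarith),
      abs_of_nonpos (a := (1 - 4 * (-1 - l) * (-1 - k)) * b + 2 * (-1 - l) * d) (by linarith),
      abs_of_nonneg (a := -2 * (-1 - k) * a + c) (by linarith),
      abs_of_nonneg (a := -2 * (-1 - k) * b + d) (by linarith)]
    have e1 := mul_nonneg hl (sub_nonneg.2 h1.le)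
    have e2 := mul_nonneg hk (sub_nonneg.2 h1.le)
    have e3 := mul_nonneg hkl (sub_nonneg.2 h1.le)
    have e4 := mul_nonneg hl (sub_nonneg.2 h4.le)
    linarith
  · exfalso
    have hm : 0 < m := by
      by_contra h
      nlinarith
    have g1 : -2 * n * b + d < 0 := by nlinarith
    have g3 : (1 - 4 * m * n) * a + 2 * m * c ≤ 0 := by
      have : c - 2 * n * a + a ≤ 0 := by nlinarith
      nlinarith
    nlinarith

/-- Lemma 3.2, inequality (3.7): if `X = [[a,b],[c,d]] ∈ Γ(2)` is decreasing
(`|a| > |b| > |d|`, `|a| > |c| > |d|`) with `ad > 0`, and `m, n` are nonzero integers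
with `mn > 0`, and the diagonal entries of `Y = A^m B^n X = [[1−4mn, 2m],[−2n, 1]]·X`
have opposite signs, then `τ(Y) ≥ τ(X) + 2`. -/
theorem decreasing_step_tau_plus_two
    (a b c d : ℤ) (hdet : a * d - b * c = 1)
    (ha : Odd a) (hd : Odd d) (hb : Even b) (hc : Even c)
    (h1 : |b| < |a|) (h2 : |d| < |b|) (h3 : |c| < |a|) (h4 : |d| < |c|)
    (had : 0 < a * d)
    (m n : ℤ) (hm : m ≠ 0) (hn : n ≠ 0) (hmn : 0 < m * n)
    (Y : Matrix (Fin 2) (Fin 2) ℤ)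
    (hY : Y = !![1 - 4 * m * n, 2 * m; -2 * n, 1] * !![a, b; c, d])
    (hdiag : Y 0 0 * Y 1 1 < 0) :
    (|a| - |b| - |c| + |d|) + 2 ≤ |Y 0 0| - |Y 0 1| - |Y 1 0| + |Y 1 1| := by
  have e00 : Y 0 0 = (1 - 4 * m * n) * a + 2 * m * c := by
    simp [hY, Matrix.mul_apply, Fin.sum_univ_two]
  have e01 : Y 0 1 = (1 - 4 * m * n) * b + 2 * m * d := by
    simp [hY, Matrix.mul_apply, Fin.sum_univ_two]
  have e10 : Y 1 0 = -2 * n * a + c := by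
    simp [hY, Matrix.mul_apply, Fin.sum_univ_two]
  have e11 : Y 1 1 = -2 * n * b + d := by
    simp [hY, Matrix.mul_apply, Fin.sum_univ_two]
  rw [e00, e11] at hdiag
  rw [e00, e01, e10, e11]
  clear e00 e01 e10 e11 hY
  have hb0 : b ≠ 0 := by
    rintro rfl
    have := abs_nonneg d
    simp at h2
    omega
  have hc0 : c ≠ 0 := by
    rintro rfl
    have := abs_nonneg d
    simp at h4
    omega
  have hbc : 0 < b * c := by
    have : b * c ≠ 0 := mul_ne_zero hb0 hc0
    omega
  rcases pos_and_pos_or_neg_and_neg_of_mul_pos had with ⟨a0, d0⟩ | ⟨a0, d0⟩ <;>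
  rcases pos_and_pos_or_neg_and_neg_of_mul_pos hbc with ⟨b0, c0⟩ | ⟨b0, c0⟩ <;>
  simp only [abs_of_pos, abs_of_neg, a0, b0, c0, d0] at h1 h2 h3 h4 ⊢
  · exact tau_key a b c d m n d0 h1 h2 h3 h4 hmn hdiag
  · have := tau_key a (-b) (-c) d (-m) (-n) d0 h1 h2 h3 h4 (by linarith)
      (by convert hdiag using 1; ring)
    rw [← abs_neg ((1 - 4 * m * n) * b + _), ← abs_neg (-2 * n * a + _)]
    convert this using 1; ring_nf
  · have := tau_key (-a) b c (-d) (-m) (-n) (by linarith) h1 h2 h3 h4 (by linarith)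
      (by convert hdiag using 1; ring)
    rw [← abs_neg ((1 - 4 * m * n) * a + _), ← abs_neg (-2 * n * b + _)]
    convert this using 1; ring_nf
  · have := tau_key (-a) (-b) (-c) (-d) m n (by linarith) h1 h2 h3 h4 hmn
      (by convert hdiag using 1; ring)
    rw [← abs_neg ((1 - 4 * m * n) * a + _), ← abs_neg (-2 * n * b + _),
      ← abs_neg ((1 - 4 * m * n) * b + _), ← abs_neg (-2 * n * a + _)]
    convert this using 1; ring_nf
end

section
/- Let k ≥ 1 and let m₁, …, m_k, n₁, …, n_k be integers. Then the (1,1) entry of the matrix product ∏_{j=1}^{k} [[1, 2m_j],[0,1]] · [[1,0],[2n_j,1]] (the product of A^{m_j} B^{−n_j} taken in order j = 1, …, k, where A^m = [[1,2m],[0,1]] and B^{−n} = [[1,0],[2n,1]]) equals Σ_{ℓ=0}^{k} 4^ℓ · Σ ∏_{s=1}^{ℓ} m_{i_s} n_{j_s}, where for each ℓ the inner sum is over all index sequences 1 ≤ i₁ ≤ j₁ < i₂ ≤ j₂ < ⋯ < i_ℓ ≤ j_ℓ ≤ k, and the ℓ = 0 term equals 1. -/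
open scoped Classical

/-- Admissible pairs of index sequences whose first index is at least `a`. -/
def EOOCond {k : ℕ} (l a : ℕ) (I J : Fin l → Fin k) : Prop :=
  ((∀ s : Fin l, I s ≤ J s) ∧ (∀ s t : Fin l, (s : ℕ) + 1 = (t : ℕ) → J s < I t)) ∧
    ∀ s : Fin l, (s : ℕ) = 0 → a ≤ (I s : ℕ)

/-- The inner sum, restricted to sequences whose first index is at least `a`. -/
noncomputable def eooS {k : ℕ} (m n : Fin k → ℤ) (l a : ℕ) : ℤ :=
  ∑ I : Fin l → Fin k, ∑ J : Fin l → Fin k,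
    if EOOCond l a I J then ∏ s : Fin l, m (I s) * n (J s) else 0

/-- The auxiliary sum attached to the (2,1) entry. -/
noncomputable def eooT {k : ℕ} (m n : Fin k → ℤ) (l a : ℕ) : ℤ :=
  ∑ j : Fin k, if a ≤ (j : ℕ) then n j * eooS m n l (j + 1) else 0

lemma eooCond_cons {k : ℕ} (l a : ℕ) (i j : Fin k) (I J : Fin l → Fin k) :
    EOOCond (l + 1) a (Fin.cons i I : Fin (l + 1) → Fin k) (Fin.cons j J : Fin (l + 1) → Fin k) ↔
      a ≤ (i : ℕ) ∧ (i : ℕ) ≤ (j : ℕ) ∧ EOOCond l (j + 1) I J := by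
  unfold EOOCond
  simp only [Fin.forall_fin_succ, Fin.cons_zero, Fin.cons_succ, Fin.val_zero, Fin.val_succ,
    Fin.le_def, Fin.lt_def]
  constructor
  · rintro ⟨⟨⟨h1, h2⟩, ⟨-, h3⟩, h4⟩, h5, -⟩
    refine ⟨h5 trivial, h1, ⟨h2, fun s t hst => (h4 s).2 t (by omega)⟩, fun s hs => ?_⟩
    have := h3 s (by omega)
    omega
  · rintro ⟨h1, h2, ⟨h3, h4⟩, h5⟩
    refine ⟨⟨⟨h2, h3⟩, ⟨fun h => by omega, fun s hs => ?_⟩,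
      fun s => ⟨fun h => by omega, fun t ht => h4 s t (by omega)⟩⟩, fun _ => h1,
      fun s hs => by omega⟩
    have := h5 s (by omega)
    omega

lemma eoo_sum_cons {k : ℕ} (l : ℕ) (f : (Fin (l + 1) → Fin k) → ℤ) :
    ∑ I, f I = ∑ i : Fin k, ∑ I : Fin l → Fin k, f (Fin.cons i I) := by
  rw [← (Fin.consEquiv (fun _ : Fin (l + 1) => Fin k)).sum_comp, Fintype.sum_prod_type]
  rfl

lemma eooS_zero {k : ℕ} (m n : Fin k → ℤ) (a : ℕ) : eooS m n 0 a = 1 := by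
  simp [eooS, EOOCond]

lemma eooS_succ {k : ℕ} (m n : Fin k → ℤ) (l a : ℕ) :
    eooS m n (l + 1) a = ∑ i : Fin k, if a ≤ (i : ℕ) then m i * eooT m n l i else 0 := by
  unfold eooS
  rw [eoo_sum_cons]
  refine Finset.sum_congr rfl fun i _ => ?_
  simp only [eoo_sum_cons (k := k) l (fun J => _)]
  rw [Finset.sum_comm]
  by_cases hi : a ≤ (i : ℕ)
  · rw [if_pos hi, eooT, Finset.mul_sum]
    refine Finset.sum_congr rfl fun j _ => ?_
    by_cases hj : (i : ℕ) ≤ (j : ℕ)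
    · rw [if_pos hj, eooS, Finset.mul_sum, Finset.mul_sum]
      refine Finset.sum_congr rfl fun I _ => ?_
      rw [Finset.mul_sum, Finset.mul_sum]
      refine Finset.sum_congr rfl fun J _ => ?_
      simp only [eooCond_cons, hi, hj, true_and, Fin.prod_univ_succ, Fin.cons_zero, Fin.cons_succ]
      split_ifs
      · ring
      · ring
    · simp [eooCond_cons, hj]
  · simp [eooCond_cons, hi]

lemma eoo_tail {k : ℕ} (g : Fin k → ℤ) (a : ℕ) (ha : a < k) :
    (∑ i : Fin k, if a ≤ (i : ℕ) then g i else 0) =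
      g ⟨a, ha⟩ + ∑ i : Fin k, if a + 1 ≤ (i : ℕ) then g i else 0 := by
  have h : g ⟨a, ha⟩ = ∑ i : Fin k, if i = ⟨a, ha⟩ then g i else 0 := by simp
  rw [h, ← Finset.sum_add_distrib]
  refine Finset.sum_congr rfl fun i _ => ?_
  simp only [Fin.ext_iff]
  split_ifs <;> omega

lemma eoo_tail_end {k : ℕ} (g : Fin k → ℤ) :
    (∑ i : Fin k, if k ≤ (i : ℕ) then g i else 0) = 0 := by
  refine Finset.sum_eq_zero fun i _ => if_neg ?_
  have := i.2
  omega

lemma eoo_main {k : ℕ} (m n : Fin k → ℤ) (d : ℕ) : ∀ a N : ℕ, a + d = k → d ≤ N →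
    (((List.ofFn (fun j : Fin k =>
        !![1, 2 * m j; 0, 1] * !![(1 : ℤ), 0; 2 * n j, 1])).drop a).prod 0 0 =
      ∑ l ∈ Finset.range (N + 1), 4 ^ l * eooS m n l a) ∧
    (((List.ofFn (fun j : Fin k =>
        !![1, 2 * m j; 0, 1] * !![(1 : ℤ), 0; 2 * n j, 1])).drop a).prod 1 0 =
      2 * ∑ l ∈ Finset.range N, 4 ^ l * eooT m n l a) := by
  induction d with
  | zero =>
    intro a N ha _
    obtain rfl : a = k := by omega
    rw [List.drop_eq_nil_of_le (by simp)]
    simp [Finset.sum_range_succ', eooS_zero, eooS_succ, eooT, eoo_tail_end]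
  | succ d ih =>
    intro a N ha hN
    have hak : a < k := by omega
    obtain ⟨M, rfl⟩ : ∃ M, N = M + 1 := ⟨N - 1, by omega⟩
    obtain ⟨hx, -⟩ := ih (a + 1) M (by omega) (by omega)
    obtain ⟨hx', hy⟩ := ih (a + 1) (M + 1) (by omega) (by omega)
    have hT : ∀ l, eooT m n l a = n ⟨a, hak⟩ * eooS m n l (a + 1) + eooT m n l (a + 1) :=
      fun l => eoo_tail _ a hak
    have hS : ∀ l, eooS m n (l + 1) a =
        m ⟨a, hak⟩ * eooT m n l a + eooS m n (l + 1) (a + 1) := fun l => by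
      rw [eooS_succ, eooS_succ, eoo_tail _ a hak]
    rw [List.drop_eq_getElem_cons (by simpa using hak), List.prod_cons, List.getElem_ofFn]
    set P := ((List.ofFn (fun j : Fin k =>
        !![1, 2 * m j; 0, 1] * !![(1 : ℤ), 0; 2 * n j, 1])).drop (a + 1)).prod with hP
    have e1 : 2 * ∑ l ∈ Finset.range (M + 1), 4 ^ l * eooT m n l a
        = 2 * n ⟨a, hak⟩ * P 0 0 + P 1 0 := by
      rw [hx, hy, Finset.mul_sum, Finset.mul_sum, Finset.mul_sum, ← Finset.sum_add_distrib]
      refine Finset.sum_congr rfl fun l _ => ?_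
      rw [hT]; ring
    have e2 : ∑ l ∈ Finset.range (M + 1 + 1), 4 ^ l * eooS m n l a
        = P 0 0 + 2 * m ⟨a, hak⟩ * (2 * ∑ l ∈ Finset.range (M + 1), 4 ^ l * eooT m n l a) := by
      rw [hx', Finset.sum_range_succ', Finset.sum_range_succ' _ (M + 1), eooS_zero, eooS_zero,
        add_right_comm, Finset.mul_sum, Finset.mul_sum, ← Finset.sum_add_distrib]
      congr 1
      refine Finset.sum_congr rfl fun l _ => ?_
      rw [hS]; ring
    rw [e2, e1]
    constructor
    · simp [Matrix.mul_apply, Fin.sum_univ_two]; ring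
    · simp [Matrix.mul_apply, Fin.sum_univ_two]

/-- Section 4, formula for the `(1,1)` entry: the top-left entry of the matrix product
`A^{m₁}B^{−n₁}⋯A^{m_k}B^{−n_k}`, where `A^m = [[1,2m],[0,1]]` and `B^{−n} = [[1,0],[2n,1]]`,
equals `Σ_{ℓ=0}^{k} 4^ℓ Σ m_{i₁}n_{j₁}⋯m_{i_ℓ}n_{j_ℓ}`, the inner sum over all index
sequences `i₁ ≤ j₁ < i₂ ≤ j₂ < ⋯ < i_ℓ ≤ j_ℓ` in `{1,…,k}` (the `ℓ = 0` term being `1`). -/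
theorem entry_one_one_formula
    (k : ℕ) (hk : 1 ≤ k) (m n : Fin k → ℤ) :
    ((List.ofFn (fun j : Fin k =>
        !![1, 2 * m j; 0, 1] * !![(1 : ℤ), 0; 2 * n j, 1])).prod) 0 0 =
      ∑ ℓ ∈ Finset.range (k + 1), 4 ^ ℓ *
        ∑ p ∈ Finset.univ.filter
            (fun p : (Fin ℓ → Fin k) × (Fin ℓ → Fin k) =>
              (∀ s : Fin ℓ, p.1 s ≤ p.2 s) ∧
              (∀ s t : Fin ℓ, (s : ℕ) + 1 = (t : ℕ) → p.2 s < p.1 t)),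
          ∏ s : Fin ℓ, m (p.1 s) * n (p.2 s) := by
  have h := (eoo_main m n k 0 k (by omega) le_rfl).1
  rw [List.drop_zero] at h
  rw [h]
  refine Finset.sum_congr rfl fun l _ => ?_
  congr 1
  rw [Finset.sum_filter, Fintype.sum_prod_type, eooS]
  simp [EOOCond]
end
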